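/- Let n ≥ 2, 0 < p, q ≤ ∞, and s_p = (n−1)(1/min(p,1) − 1). There exists a constant C > 0 such that for every Schwartz function f ∈ 𝒮(ℝⁿ), ‖Tr f‖_{B^{s_p}_{p,q}(ℝ^{n−1})} ≤ C ‖f‖_{B̃^{s_p + 1/p}_{p, min(p,q,1)}(ℝⁿ)}. -/

import Mathlib

open MeasureTheory FourierTransform
open scoped ENNReal NNReal

noncomputable section

/-- `η` is an admissible bump function: smooth, valued in `[0,1]`, equal to `1` on `|t| ≤ 1`
and vanishing for `|t| ≥ 2`. -/
def IsBump (η : ℝ → ℝ) : Prop :=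
  ContDiff ℝ (⊤ : ℕ∞) η ∧ (∀ t, η t ∈ Set.Icc (0:ℝ) 1) ∧ (∀ t, |t| ≤ 1 → η t = 1) ∧
    (∀ t, 2 ≤ |t| → η t = 0)

/-- The Littlewood–Paley pieces: `φ_0(ξ) = η(|ξ|)`,
`φ_j(ξ) = η(2^{-j}|ξ|) - η(2^{-j+1}|ξ|)` for `j ≥ 1`. -/
def littlewood (η : ℝ → ℝ) {d : ℕ} (j : ℕ) (ξ : EuclideanSpace ℝ (Fin d)) : ℝ :=
  if j = 0 then η ‖ξ‖
  else η ((2:ℝ) ^ (-(j:ℝ)) * ‖ξ‖) - η ((2:ℝ) ^ (-(j:ℝ) + 1) * ‖ξ‖)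

/-- The dyadic decomposition operator `Δ_j f = 𝓕⁻¹(φ_j 𝓕 f)`. -/
def dyadicBox (η : ℝ → ℝ) {d : ℕ} (j : ℕ) (f : EuclideanSpace ℝ (Fin d) → ℂ) :
    EuclideanSpace ℝ (Fin d) → ℂ :=
  𝓕⁻ (fun ξ => (littlewood η j ξ : ℂ) * 𝓕 f ξ)

/-- The `ℓ^q` combination of a family of extended nonnegative reals, with the supremum
modification for `q = ∞`. -/
def lqSum {ι : Type*} (q : ℝ≥0∞) (a : ι → ℝ≥0∞) : ℝ≥0∞ :=
  if q = ∞ then ⨆ i, a i else (∑' i, a i ^ q.toReal) ^ (1 / q.toReal)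

/-- The Besov quasi-norm `‖f‖_{B^s_{p,q}(ℝ^d)} = (Σ_j 2^{jsq} ‖Δ_j f‖_p^q)^{1/q}`. -/
def besovNorm (η : ℝ → ℝ) {d : ℕ} (s : ℝ) (p q : ℝ≥0∞)
    (f : EuclideanSpace ℝ (Fin d) → ℂ) : ℝ≥0∞ :=
  lqSum q (fun j : ℕ =>
    ENNReal.ofReal ((2:ℝ) ^ ((j:ℝ) * s)) * eLpNorm (dyadicBox η j f) p volume)

/-- The logarithmically weighted Besov quasi-norm
`‖f‖_{B̃^s_{p,q}(ℝ^d)} = (Σ_j (1+j) 2^{jsq} ‖Δ_j f‖_p^q)^{1/q}`. -/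
def besovNormLog (η : ℝ → ℝ) {d : ℕ} (s : ℝ) (p q : ℝ≥0∞)
    (f : EuclideanSpace ℝ (Fin d) → ℂ) : ℝ≥0∞ :=
  if q = ∞ then
    ⨆ j : ℕ, ENNReal.ofReal ((2:ℝ) ^ ((j:ℝ) * s)) * eLpNorm (dyadicBox η j f) p volume
  else
    (∑' j : ℕ, (1 + (j:ℝ≥0∞)) *
        (ENNReal.ofReal ((2:ℝ) ^ ((j:ℝ) * s)) *
          eLpNorm (dyadicBox η j f) p volume) ^ q.toReal) ^ (1 / q.toReal)

/-- The trace `(Tr f)(x̄) = f(x̄, 0)` on the hyperplane `x_n = 0`. -/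
def traceFn {m : ℕ} (f : EuclideanSpace ℝ (Fin (m+1)) → ℂ)
    (x : EuclideanSpace ℝ (Fin m)) : ℂ :=
  f ((WithLp.equiv 2 (Fin (m+1) → ℝ)).symm
      (Fin.snoc ((WithLp.equiv 2 (Fin m → ℝ)) x) 0))

section Part1
open MeasureTheory FourierTransform
open scoped ENNReal NNReal

/-- The character as a complex number. -/
def ech (t : ℝ) : ℂ := (Real.fourierChar t : ℂ)

lemma ech_continuous : Continuous ech :=
  continuous_subtype_val.comp Real.continuous_fourierChar

lemma norm_ech (t : ℝ) : ‖ech t‖ = 1 := Circle.norm_coe _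

lemma ech_add (s t : ℝ) : ech (s + t) = ech s * ech t := by
  simp [ech, AddChar.map_add_eq_mul]

lemma ech_zero : ech 0 = 1 := by simp [ech]

section gen
variable {V : Type*} [NormedAddCommGroup V] [InnerProductSpace ℝ V] [MeasurableSpace V]
  [BorelSpace V] [FiniteDimensional ℝ V]

lemma fourier_eq_ech (f : V → ℂ) (w : V) : 𝓕 f w = ∫ v, ech (-inner ℝ v w) * f v := by
  rw [Real.fourier_eq]; rfl

lemma fourierInv_eq_ech (f : V → ℂ) (w : V) : 𝓕⁻ f w = ∫ v, ech (inner ℝ v w) * f v := by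
  rw [Real.fourierInv_eq]; rfl

lemma integrable_ech_mul {f : V → ℂ} (hf : Integrable f) {B : V → ℝ} (hB : Continuous B) :
    Integrable (fun v => ech (B v) * f v) := by
  refine hf.mono ((ech_continuous.comp hB).aestronglyMeasurable.mul hf.1) ?_
  filter_upwards with v
  simp [norm_ech]

variable {W : Type*} [NormedAddCommGroup W] [InnerProductSpace ℝ W] [MeasurableSpace W]
  [BorelSpace W] [FiniteDimensional ℝ W]

lemma fubini_ech {a : V → ℂ} {b : W → ℂ} (ha : Integrable a) (hb : Integrable b)
    {B : V → W → ℝ} (hB : Continuous (Function.uncurry B)) :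
    ∫ v, a v * ∫ w, ech (B v w) * b w = ∫ w, (∫ v, ech (B v w) * a v) * b w := by
  have h1 : ∀ v, a v * ∫ w, ech (B v w) * b w = ∫ w, ech (B v w) * (a v * b w) := by
    intro v
    rw [← integral_const_mul]; congr 1; ext w; ring
  have h2 : ∀ w, (∫ v, ech (B v w) * a v) * b w = ∫ v, ech (B v w) * (a v * b w) := by
    intro w
    rw [← integral_mul_const]; congr 1; ext w; ring
  simp_rw [h1, h2]
  rw [integral_integral_swap]
  have := ha.mul_prod hb
  refine this.mono ((ech_continuous.comp hB).aestronglyMeasurable.mul this.1) ?_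
  filter_upwards with v
  simp [norm_ech, Function.uncurry]

lemma fourierInv_scale (a : V → ℂ) {c : ℝ} (hc : 0 < c) (x : V) :
    𝓕⁻ (fun ξ => a (c • ξ)) x = ((c ^ Module.finrank ℝ V)⁻¹ : ℝ) * 𝓕⁻ a (c⁻¹ • x) := by
  rw [fourierInv_eq_ech, fourierInv_eq_ech]
  have := Measure.integral_comp_smul (volume : Measure V)
    (fun ξ => ech (inner ℝ ξ (c⁻¹ • x)) * a ξ) c
  rw [abs_of_pos (by positivity)] at this
  rw [← Complex.real_smul, ← this]
  congr 1; ext ξ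
  rw [inner_smul_left, inner_smul_right]
  simp only [RCLike.conj_to_real]
  rw [mul_inv_cancel_left₀ hc.ne']

lemma norm_fourierInv_le (a : V → ℂ) (x : V) : ‖𝓕⁻ a x‖ ≤ ∫ v, ‖a v‖ := by
  rw [fourierInv_eq_ech]
  refine (norm_integral_le_integral_norm _).trans (le_of_eq ?_)
  simp [norm_ech]

lemma norm_fourier_le (a : V → ℂ) (x : V) : ‖𝓕 a x‖ ≤ ∫ v, ‖a v‖ := by
  rw [fourier_eq_ech]
  refine (norm_integral_le_integral_norm _).trans (le_of_eq ?_)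
  simp [norm_ech]

/-- Bernstein/Nikolskii sup bound. -/
lemma sup_le_of_fourier_supp {h : V → ℂ} (hc : Continuous h) (hi : Integrable h) {R : ℝ}
    (hs : ∀ ξ, R < ‖ξ‖ → 𝓕 h ξ = 0) (y : V) :
    ‖h y‖ ≤ (volume (Metric.closedBall (0:V) R)).toReal * ∫ v, ‖h v‖ := by
  have hF : Continuous (𝓕 h) :=
    VectorFourier.fourierIntegral_continuous Real.continuous_fourierChar
      (by exact continuous_inner) hi
  have hle : ∀ ξ, ‖𝓕 h ξ‖ ≤ (Metric.closedBall (0:V) R).indicator (fun _ => ∫ v, ‖h v‖) ξ := by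
    intro ξ
    by_cases hξ : ξ ∈ Metric.closedBall (0:V) R
    · rw [Set.indicator_of_mem hξ]; exact norm_fourier_le _ _
    · rw [Set.indicator_of_notMem hξ, hs ξ (by simpa using hξ)]; simp
  have hintg : Integrable ((Metric.closedBall (0:V) R).indicator (fun _ => ∫ v, ‖h v‖)) := by
    rw [integrable_indicator_iff Metric.isClosed_closedBall.measurableSet]
    exact integrableOn_const (by exact (isCompact_closedBall _ _).measure_lt_top.ne)
  have hFi : Integrable (𝓕 h) :=
    hintg.mono' hF.aestronglyMeasurable (Filter.Eventually.of_forall hle)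
  have hinv := congrFun (hc.fourierInv_fourier_eq hi hFi) y
  rw [← hinv]
  refine (norm_fourierInv_le _ _).trans ?_
  refine (integral_mono hFi.norm hintg hle).trans ?_
  rw [integral_indicator Metric.isClosed_closedBall.measurableSet]
  simp [Measure.real]

end gen

variable {m : ℕ}

/-- Projection to the first `m` coordinates. -/
def prj (y : EuclideanSpace ℝ (Fin (m+1))) : EuclideanSpace ℝ (Fin m) :=
  WithLp.toLp 2 (fun i => y i.castSucc)

/-- Last coordinate. -/
def lst (y : EuclideanSpace ℝ (Fin (m+1))) : ℝ := y (Fin.last m)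

lemma prj_continuous : Continuous (prj (m := m)) := by unfold prj; fun_prop
lemma lst_continuous : Continuous (lst (m := m)) := by unfold lst; fun_prop

lemma prj_contDiff {n : ℕ∞} : ContDiff ℝ n (prj (m := m)) := by
  rw [contDiff_euclidean]; intro i; unfold prj; simp only; fun_prop

lemma prj_sub (x y : EuclideanSpace ℝ (Fin (m+1))) : prj (x - y) = prj x - prj y := by
  ext i; simp [prj]
lemma lst_sub (x y : EuclideanSpace ℝ (Fin (m+1))) : lst (x - y) = lst x - lst y := by
  simp [lst]

lemma inner_split (y ξ : EuclideanSpace ℝ (Fin (m+1))) :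
    inner ℝ y ξ = inner ℝ (prj y) (prj ξ) + lst y * lst ξ := by
  simp [PiLp.inner_apply, Fin.sum_univ_castSucc, prj, lst, mul_comm]

lemma norm_sq_split (y : EuclideanSpace ℝ (Fin (m+1))) :
    ‖y‖ ^ 2 = ‖prj y‖ ^ 2 + lst y ^ 2 := by
  have := inner_split y y
  rw [real_inner_self_eq_norm_sq, real_inner_self_eq_norm_sq] at this
  rw [this]; ring

lemma norm_prj_le (y : EuclideanSpace ℝ (Fin (m+1))) : ‖prj y‖ ≤ ‖y‖ := by
  have := norm_sq_split y
  exact le_of_sq_le_sq (by nlinarith [sq_nonneg (lst y)]) (norm_nonneg _)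
  
lemma abs_lst_le (y : EuclideanSpace ℝ (Fin (m+1))) : |lst y| ≤ ‖y‖ := by
  have := norm_sq_split y
  exact abs_le_of_sq_le_sq (by nlinarith [sq_nonneg ‖prj y‖]) (norm_nonneg _)

lemma norm_le_split (y : EuclideanSpace ℝ (Fin (m+1))) : ‖y‖ ≤ ‖prj y‖ + |lst y| := by
  have := norm_sq_split y
  refine le_of_sq_le_sq ?_ (by positivity)
  rw [this, add_sq, sq_abs]
  have : 0 ≤ 2 * ‖prj y‖ * |lst y| := by positivity
  linarith

def splitEquiv : EuclideanSpace ℝ (Fin (m+1)) ≃ᵐ ℝ × EuclideanSpace ℝ (Fin m) :=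
  ((MeasurableEquiv.toLp 2 (Fin (m+1) → ℝ)).symm.trans
    (MeasurableEquiv.piFinSuccAbove (fun _ => ℝ) (Fin.last m))).trans
    ((MeasurableEquiv.refl ℝ).prodCongr (MeasurableEquiv.toLp 2 (Fin m → ℝ)))

lemma splitEquiv_apply (y : EuclideanSpace ℝ (Fin (m+1))) :
    splitEquiv y = (lst y, prj y) := by
  refine Prod.ext rfl ?_
  ext i
  simp [splitEquiv, prj, MeasurableEquiv.piFinSuccAbove, MeasurableEquiv.prodCongr]
  rfl

lemma splitEquiv_mp : MeasurePreserving (splitEquiv (m := m)) volume (volume.prod volume) := by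
  unfold splitEquiv
  refine MeasurePreserving.trans (MeasurePreserving.trans
    (EuclideanSpace.volume_preserving_symm_measurableEquiv_toLp _)
    (volume_preserving_piFinSuccAbove (fun _ => ℝ) (Fin.last m))) ?_
  exact (MeasurePreserving.id _).prod
    (EuclideanSpace.volume_preserving_symm_measurableEquiv_toLp _).symm

lemma integral_split (a : ℝ → ℂ) (b : EuclideanSpace ℝ (Fin m) → ℂ) :
    ∫ y, a (lst y) * b (prj y) = (∫ t, a t) * ∫ x, b x := by
  rw [← integral_prod_mul, ← splitEquiv_mp.integral_comp' ]
  simp [splitEquiv_apply]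

lemma lintegral_split {a : ℝ → ℝ≥0∞} {b : EuclideanSpace ℝ (Fin m) → ℝ≥0∞}
    (ha : AEMeasurable a) (hb : AEMeasurable b) :
    ∫⁻ y, a (lst y) * b (prj y) = (∫⁻ t, a t) * ∫⁻ x, b x := by
  rw [← lintegral_prod_mul ha hb, ← splitEquiv_mp.map_eq,
    lintegral_map_equiv]
  simp [splitEquiv_apply]

lemma integrable_split {a : ℝ → ℂ} {b : EuclideanSpace ℝ (Fin m) → ℂ}
    (ha : Integrable a) (hb : Integrable b) :
    Integrable (fun y => a (lst y) * b (prj y)) := by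
  have := (splitEquiv_mp (m := m)).integrable_comp_emb splitEquiv.measurableEmbedding
    |>.2 (ha.mul_prod hb)
  refine this.congr (Filter.Eventually.of_forall fun y => ?_)
  simp [splitEquiv_apply]

end Part1

section Part2
open MeasureTheory FourierTransform
open scoped ENNReal NNReal SchwartzMap ContDiff

lemma lw_eq (η : ℝ → ℝ) {d : ℕ} (j : ℕ) (ξ : EuclideanSpace ℝ (Fin d)) :
    littlewood η j ξ = if j = 0 then η ‖ξ‖ else
      η (((2:ℝ) ^ j)⁻¹ * ‖ξ‖) - η (2 * (((2:ℝ) ^ j)⁻¹ * ‖ξ‖)) := by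
  unfold littlewood
  rw [Real.rpow_add (by norm_num), Real.rpow_neg (by norm_num), Real.rpow_natCast, Real.rpow_one]
  congr 3
  ring

lemma lw_zero_large {η : ℝ → ℝ} (hη : IsBump η) {d : ℕ} (j : ℕ) (ξ : EuclideanSpace ℝ (Fin d))
    (h : (2:ℝ) ^ (j + 1) ≤ ‖ξ‖) : littlewood η j ξ = 0 := by
  rw [lw_eq]
  have h2 : 2 ≤ ((2:ℝ) ^ j)⁻¹ * ‖ξ‖ := by
    rw [← div_eq_inv_mul, le_div_iff₀ (by positivity)]; rw [pow_succ] at h; linarith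
  have e1 := hη.2.2.2 (((2:ℝ) ^ j)⁻¹ * ‖ξ‖) (h2.trans (le_abs_self _))
  have e2 := hη.2.2.2 (2 * (((2:ℝ) ^ j)⁻¹ * ‖ξ‖)) (le_trans (by linarith) (le_abs_self _))
  split_ifs with hj
  · subst hj; simpa using e1
  · rw [e1, e2, sub_zero]

lemma lw_zero_small {η : ℝ → ℝ} (hη : IsBump η) {d : ℕ} (j : ℕ) (ξ : EuclideanSpace ℝ (Fin d))
    (h : ‖ξ‖ ≤ (2:ℝ) ^ j) : littlewood η (j + 1) ξ = 0 := by
  rw [lw_eq, if_neg (by omega)]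
  have h2 : 2 * (((2:ℝ) ^ (j + 1))⁻¹ * ‖ξ‖) ≤ 1 := by
    rw [← div_eq_inv_mul, ← mul_div_assoc, div_le_one (by positivity), pow_succ]; linarith
  have h0 : 0 ≤ ((2:ℝ) ^ (j + 1))⁻¹ * ‖ξ‖ := by positivity
  rw [hη.2.2.1, hη.2.2.1, sub_self] <;> rw [abs_of_nonneg] <;> linarith

lemma lw_sum (η : ℝ → ℝ) {d : ℕ} (N : ℕ) (ξ : EuclideanSpace ℝ (Fin d)) :
    ∑ k ∈ Finset.range (N + 1), littlewood η k ξ = η (((2:ℝ) ^ N)⁻¹ * ‖ξ‖) := by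
  induction N with
  | zero => simp [littlewood]
  | succ N ih =>
    rw [Finset.sum_range_succ, ih, lw_eq, if_neg (by omega)]
    have : 2 * (((2:ℝ) ^ (N + 1))⁻¹ * ‖ξ‖) = ((2:ℝ) ^ N)⁻¹ * ‖ξ‖ := by
      rw [pow_succ]; field_simp
    rw [this]; ring

lemma lw_abs_le {η : ℝ → ℝ} (hη : IsBump η) {d : ℕ} (j : ℕ) (ξ : EuclideanSpace ℝ (Fin d)) :
    |littlewood η j ξ| ≤ 1 := by
  rw [lw_eq, abs_le]
  have := hη.2.1
  split_ifs
  · have h := this ‖ξ‖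
    constructor <;> linarith [h.1, h.2]
  · have h := this (((2:ℝ) ^ j)⁻¹ * ‖ξ‖)
    have h' := this (2 * (((2:ℝ) ^ j)⁻¹ * ‖ξ‖))
    constructor <;> linarith [h.1, h.2, h'.1, h'.2]

section rad
variable {V : Type*} [NormedAddCommGroup V] [InnerProductSpace ℝ V]

lemma rad_contDiff {η : ℝ → ℝ} (hη : IsBump η) {c : ℝ} (hc : 0 < c) :
    ContDiff ℝ ∞ (fun ξ : V => η (c * ‖ξ‖)) := by
  rw [contDiff_iff_contDiffAt]
  intro ξ
  by_cases h : ξ = 0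
  · subst h
    have : (fun ξ : V => η (c * ‖ξ‖)) =ᶠ[nhds 0] fun _ => 1 := by
      have : Metric.ball (0:V) c⁻¹ ∈ nhds 0 := Metric.ball_mem_nhds _ (by positivity)
      filter_upwards [this] with x hx
      apply hη.2.2.1
      rw [abs_of_nonneg (by positivity)]
      rw [mem_ball_zero_iff] at hx
      have := mul_lt_mul_of_pos_left hx hc
      rw [mul_inv_cancel₀ hc.ne'] at this
      exact this.le
    exact contDiffAt_const.congr_of_eventuallyEq this
  · exact hη.1.contDiffAt.comp ξ (contDiffAt_const.mul (contDiffAt_norm ℝ h))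

lemma rad_schwartz [FiniteDimensional ℝ V] {η : ℝ → ℝ} (hη : IsBump η) {c : ℝ} (hc : 0 < c) :
    ∃ a : 𝓢(V, ℂ), ∀ ξ, a ξ = (η (c * ‖ξ‖) : ℂ) := by
  have h1 : ContDiff ℝ ∞ (fun ξ : V => (η (c * ‖ξ‖) : ℂ)) :=
    Complex.ofRealCLM.contDiff.comp (rad_contDiff hη hc)
  have h2 : HasCompactSupport (fun ξ : V => (η (c * ‖ξ‖) : ℂ)) := by
    refine HasCompactSupport.intro (isCompact_closedBall (0:V) (2 / c)) ?_
    intro x hx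
    rw [mem_closedBall_zero_iff, not_le, div_lt_iff₀ hc] at hx
    rw [hη.2.2.2, Complex.ofReal_zero]
    rw [abs_of_nonneg (by positivity)]; linarith
  exact ⟨h2.toSchwartzMap h1, fun ξ => rfl⟩
end rad

lemma lw_schwartz {η : ℝ → ℝ} (hη : IsBump η) {d : ℕ} (j : ℕ) :
    ∃ a : 𝓢(EuclideanSpace ℝ (Fin d), ℂ), ∀ ξ, a ξ = (littlewood η j ξ : ℂ) := by
  obtain ⟨a0, h0⟩ := rad_schwartz (V := EuclideanSpace ℝ (Fin d)) hη (c := 1) one_pos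
  obtain ⟨a1, h1⟩ := rad_schwartz (V := EuclideanSpace ℝ (Fin d)) hη (c := (2 ^ j)⁻¹)
    (by positivity)
  obtain ⟨a2, h2⟩ := rad_schwartz (V := EuclideanSpace ℝ (Fin d)) hη (c := 2 * (2 ^ j)⁻¹)
    (by positivity)
  by_cases hj : j = 0
  · exact ⟨a0, fun ξ => by rw [lw_eq, h0, if_pos hj, one_mul]⟩
  · refine ⟨a1 - a2, fun ξ => by
      rw [lw_eq, if_neg hj, sub_apply, h1, h2, Complex.ofReal_sub, mul_assoc]⟩

/-- base profile -/
lemma lw_base (η : ℝ → ℝ) {d : ℕ} (j : ℕ) (ξ : EuclideanSpace ℝ (Fin d)) :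
    littlewood η j ξ = if j = 0 then littlewood η 0 ξ else
      littlewood η 1 ((2 * ((2:ℝ) ^ j)⁻¹) • ξ) := by
  split_ifs with hj
  · rw [hj]
  · rw [lw_eq, if_neg hj, lw_eq, if_neg (by omega), norm_smul, Real.norm_of_nonneg (by positivity)]
    congr 2 <;> ring

lemma schwartz_mul_schwartz {V : Type*} [NormedAddCommGroup V] [InnerProductSpace ℝ V]
    [FiniteDimensional ℝ V] {a : V → ℂ} (b : 𝓢(V, ℂ)) (ha : ContDiff ℝ ∞ a)
    (hs : HasCompactSupport a) : ∃ c : 𝓢(V, ℂ), ∀ x, c x = a x * b x := by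
  exact ⟨(hs.mul_right (f' := b)).toSchwartzMap (ha.mul b.smooth'), fun x => rfl⟩

lemma lintegral_smul_scale {V : Type*} [NormedAddCommGroup V] [InnerProductSpace ℝ V]
    [MeasurableSpace V] [BorelSpace V] [FiniteDimensional ℝ V] (F : V → ℝ≥0∞) (c : ℝ)
    (hc : 0 < c) :
    ∫⁻ x, F (c⁻¹ • x) = ENNReal.ofReal (c ^ Module.finrank ℝ V) * ∫⁻ x, F x := by
  have h := Measure.map_addHaar_smul (volume : Measure V) (inv_ne_zero hc.ne')
  have e : ∫⁻ x, F (c⁻¹ • x) = ∫⁻ x, F x ∂(Measure.map (c⁻¹ • ·) volume) := by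
    have := lintegral_map_equiv F (MeasurableEquiv.smul₀ c⁻¹ (inv_ne_zero hc.ne') (α := V))
      (μ := volume)
    exact this.symm
  rw [e, h, lintegral_smul_measure, abs_of_nonneg (by positivity)]
  simp

lemma kernel_scale {V : Type*} [NormedAddCommGroup V] [InnerProductSpace ℝ V]
    [MeasurableSpace V] [BorelSpace V] [FiniteDimensional ℝ V] (A : V → ℂ) {c r : ℝ}
    (hc : 0 < c) (hr : 0 < r) :
    ∫⁻ x, ‖𝓕⁻ (fun ξ => A (c • ξ)) x‖ₑ ^ r =
      ENNReal.ofReal (c ^ ((Module.finrank ℝ V : ℝ) * (1 - r))) * ∫⁻ x, ‖𝓕⁻ A x‖ₑ ^ r := by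
  simp_rw [fourierInv_scale A hc, enorm_mul, ENNReal.mul_rpow_of_nonneg _ _ hr.le]
  rw [lintegral_const_mul' _ _ (by simp [hr.le]),
    lintegral_smul_scale (fun x => ‖𝓕⁻ A x‖ₑ ^ r) c hc, ← mul_assoc]
  congr 1
  rw [← ofReal_norm, Complex.norm_real, Real.norm_of_nonneg (by positivity),
    ENNReal.ofReal_rpow_of_nonneg (by positivity) hr.le, ← ENNReal.ofReal_mul (by positivity)]
  congr 1
  rw [← Real.rpow_natCast, ← Real.rpow_neg hc.le, ← Real.rpow_mul hc.le, ← Real.rpow_add hc]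
  congr 1; ring

lemma schwartz_lintegral_lt_top {V : Type*} [NormedAddCommGroup V] [InnerProductSpace ℝ V]
    [MeasurableSpace V] [BorelSpace V] [FiniteDimensional ℝ V] (a : 𝓢(V, ℂ)) {r : ℝ}
    (hr : 0 < r) : ∫⁻ x, ‖𝓕⁻ (a : V → ℂ) x‖ₑ ^ r < ⊤ := by
  have h := (𝓕⁻ a).eLpNorm_lt_top (ENNReal.ofReal r)
  have := lintegral_rpow_enorm_lt_top_of_eLpNorm_lt_top (by simpa using hr) (by simp) h
  rw [ENNReal.toReal_ofReal hr.le] at this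
  rwa [SchwartzMap.fourierInv_coe] at this

/-- `L^r` size of the Littlewood-Paley kernels. -/
lemma lw_kernel_bound {η : ℝ → ℝ} (hη : IsBump η) (d : ℕ) {r : ℝ} (hr : 0 < r) :
    ∃ D : ℝ≥0∞, D ≠ ⊤ ∧ ∀ j : ℕ,
      ∫⁻ x, ‖𝓕⁻ (fun ξ : EuclideanSpace ℝ (Fin d) => (littlewood η j ξ : ℂ)) x‖ₑ ^ r ≤
        D * ENNReal.ofReal ((2:ℝ) ^ ((j:ℝ) * (d * (r - 1)))) := by
  obtain ⟨a0, h0⟩ := lw_schwartz hη (d := d) 0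
  obtain ⟨a1, h1⟩ := lw_schwartz hη (d := d) 1
  have e0 := schwartz_lintegral_lt_top a0 hr
  have e1 := schwartz_lintegral_lt_top a1 hr
  refine ⟨(∫⁻ x, ‖𝓕⁻ (a0 : _ → ℂ) x‖ₑ ^ r) +
    ENNReal.ofReal ((2:ℝ) ^ ((d:ℝ) * (1 - r))) * (∫⁻ x, ‖𝓕⁻ (a1 : _ → ℂ) x‖ₑ ^ r), ?_, ?_⟩
  · exact ENNReal.add_ne_top.2 ⟨e0.ne, ENNReal.mul_ne_top (by simp) e1.ne⟩
  intro j
  by_cases hj : j = 0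
  · subst hj
    have : (fun ξ : EuclideanSpace ℝ (Fin d) => (littlewood η 0 ξ : ℂ)) = a0 :=
      funext fun ξ => (h0 ξ).symm
    rw [this]; simp
  · have : (fun ξ : EuclideanSpace ℝ (Fin d) => (littlewood η j ξ : ℂ)) =
        fun ξ => a1 ((2 * ((2:ℝ) ^ j)⁻¹) • ξ) := by
      ext ξ; rw [h1, lw_base, if_neg hj]
    rw [this, kernel_scale _ (by positivity) hr, finrank_euclideanSpace_fin,
      Real.mul_rpow (by norm_num) (by positivity), ENNReal.ofReal_mul (by positivity),
      Real.inv_rpow (by positivity), ← Real.rpow_natCast, ← Real.rpow_mul (by norm_num),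
      ← Real.rpow_neg (by norm_num)]
    have : -((j:ℝ) * (d * (1 - r))) = j * (d * (r - 1)) := by ring
    rw [this, add_mul, mul_right_comm]
    exact le_add_self

/-- The one-dimensional cutoffs. -/
lemma chi_exists {η : ℝ → ℝ} (hη : IsBump η) :
    ∃ D : ℝ≥0∞, D ≠ ⊤ ∧ ∀ k : ℕ, ∃ χ : 𝓢(ℝ, ℂ), (∀ t, |t| ≤ 2 ^ (k + 1) → χ t = 1) ∧
      (∀ t, 2 ^ (k + 2) ≤ |t| → χ t = 0) ∧ (∫⁻ t, ‖𝓕⁻ (χ : ℝ → ℂ) t‖ₑ ≤ D) ∧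
      ∀ t, ‖𝓕⁻ (χ : ℝ → ℂ) t‖ₑ ≤ ENNReal.ofReal (2 ^ (k + 3)) := by
  obtain ⟨a, ha⟩ := rad_schwartz (V := ℝ) hη (c := 1) one_pos
  have e0 := schwartz_lintegral_lt_top a one_pos
  simp only [ENNReal.rpow_one] at e0
  refine ⟨_, e0.ne, fun k => ?_⟩
  obtain ⟨χ, hχ⟩ := rad_schwartz (V := ℝ) hη (c := (2 ^ (k + 1))⁻¹) (by positivity)
  have h0 : ∀ t, 2 ^ (k + 2) ≤ |t| → χ t = 0 := by
    intro t ht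
    rw [hχ, hη.2.2.2, Complex.ofReal_zero]
    rw [abs_of_nonneg (by positivity), ← div_eq_inv_mul, le_div_iff₀ (by positivity)]
    rw [pow_succ] at ht; simpa [mul_comm] using ht
  refine ⟨χ, ?_, h0, ?_, ?_⟩
  · intro t ht
    rw [hχ, hη.2.2.1, Complex.ofReal_one]
    rw [abs_of_nonneg (by positivity), ← div_eq_inv_mul, div_le_one (by positivity)]
    simpa using ht
  · have : (χ : ℝ → ℂ) = fun t => a (((2:ℝ) ^ (k + 1))⁻¹ • t) := by
      ext t; rw [hχ, ha, norm_smul, Real.norm_of_nonneg (by positivity : (0:ℝ) ≤ (2 ^ (k + 1))⁻¹), one_mul]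
    rw [this]
    have := kernel_scale (V := ℝ) a (c := (2 ^ (k + 1))⁻¹) (by positivity) one_pos
    simp only [ENNReal.rpow_one, sub_self, mul_zero, Real.rpow_zero, ENNReal.ofReal_one,
      one_mul] at this
    exact this.le
  · intro t
    rw [← ofReal_norm]
    apply ENNReal.ofReal_le_ofReal
    refine (norm_fourierInv_le _ _).trans ?_
    have hle : ∀ t, ‖χ t‖ ≤ (Metric.closedBall (0:ℝ) (2 ^ (k + 2))).indicator (fun _ => (1:ℝ)) t := by
      intro t
      by_cases ht : t ∈ Metric.closedBall (0:ℝ) (2 ^ (k + 2))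
      · rw [Set.indicator_of_mem ht, hχ, Complex.norm_real, Real.norm_of_nonneg (hη.2.1 _).1]
        exact (hη.2.1 _).2
      · rw [Set.indicator_of_notMem ht, h0, norm_zero]
        rw [mem_closedBall_zero_iff, not_le] at ht; exact ht.le
    have hintg : Integrable ((Metric.closedBall (0:ℝ) (2 ^ (k + 2))).indicator (fun _ => (1:ℝ))) := by
      rw [integrable_indicator_iff Metric.isClosed_closedBall.measurableSet]
      exact integrableOn_const (by exact (isCompact_closedBall _ _).measure_lt_top.ne)
    refine (integral_mono χ.integrable.norm hintg hle).trans ?_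
    rw [integral_indicator Metric.isClosed_closedBall.measurableSet]
    simp [Measure.real, pow_succ]
    linarith

end Part2

section Part3
open MeasureTheory FourierTransform
open scoped ENNReal NNReal SchwartzMap

section gen
variable {V : Type*} [NormedAddCommGroup V] [InnerProductSpace ℝ V] [MeasurableSpace V]
  [BorelSpace V] [FiniteDimensional ℝ V]

lemma schwartz_inv_integrable (a : 𝓢(V, ℂ)) : Integrable (𝓕⁻ (a : V → ℂ)) := by
  rw [← SchwartzMap.fourierInv_coe]; exact (𝓕⁻ a).integrable

lemma schwartz_inv_continuous (a : 𝓢(V, ℂ)) : Continuous (𝓕⁻ (a : V → ℂ)) := by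
  rw [← SchwartzMap.fourierInv_coe]; exact (𝓕⁻ a).continuous

lemma schwartz_fourier_inv (a : 𝓢(V, ℂ)) : 𝓕 (𝓕⁻ (a : V → ℂ)) = a := by
  rw [← SchwartzMap.fourierInv_coe, ← SchwartzMap.fourier_coe, fourier_fourierInv_eq]

lemma schwartz_inv_fourier (a : 𝓢(V, ℂ)) : 𝓕⁻ (𝓕 (a : V → ℂ)) = a := by
  rw [← SchwartzMap.fourier_coe, ← SchwartzMap.fourierInv_coe, fourierInv_fourier_eq]

lemma conv_ech (a : 𝓢(V, ℂ)) (x ζ : V) :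
    ∫ y, ech (inner ℝ y ζ) * 𝓕⁻ (a : V → ℂ) (x - y) = ech (inner ℝ x ζ) * a ζ := by
  have h := integral_sub_left_eq_self
    (fun u => ech (inner ℝ (x - u) ζ) * 𝓕⁻ (a : V → ℂ) u) volume x
  simp only [sub_sub_cancel] at h
  rw [h]
  conv_rhs => rw [← schwartz_fourier_inv a, fourier_eq_ech, ← integral_const_mul]
  congr 1; ext u
  rw [← mul_assoc, ← ech_add, inner_sub_left, sub_eq_add_neg]
end gen

variable {m : ℕ}

/-- The embedding of the hyperplane. -/
def embL : EuclideanSpace ℝ (Fin m) →ₗ[ℝ] EuclideanSpace ℝ (Fin (m+1)) where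
  toFun x := (WithLp.equiv 2 (Fin (m+1) → ℝ)).symm
      (Fin.snoc ((WithLp.equiv 2 (Fin m → ℝ)) x) 0)
  map_add' x y := by
    ext i
    refine Fin.lastCases ?_ (fun i => ?_) i <;> simp
  map_smul' c y := by
    ext i
    refine Fin.lastCases ?_ (fun i => ?_) i <;> simp

lemma prj_emb (x : EuclideanSpace ℝ (Fin m)) : prj (embL x) = x := by
  ext i; simp [prj, embL]
lemma lst_emb (x : EuclideanSpace ℝ (Fin m)) : lst (embL x) = 0 := by
  simp [lst, embL]

lemma norm_emb (x : EuclideanSpace ℝ (Fin m)) : ‖embL x‖ = ‖x‖ := by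
  have := norm_sq_split (embL x)
  rw [prj_emb, lst_emb] at this
  refine (pow_left_inj₀ (norm_nonneg _) (norm_nonneg _) two_ne_zero).1 (by linarith)

def embI : EuclideanSpace ℝ (Fin m) →ₗᵢ[ℝ] EuclideanSpace ℝ (Fin (m+1)) := ⟨embL, norm_emb⟩

lemma trace_eq (f : EuclideanSpace ℝ (Fin (m+1)) → ℂ) (x : EuclideanSpace ℝ (Fin m)) :
    traceFn f x = f (embI x) := rfl

lemma inner_emb (x : EuclideanSpace ℝ (Fin m)) (ξ : EuclideanSpace ℝ (Fin (m+1))) :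
    inner ℝ ξ (embI x) = inner ℝ x (prj ξ) := by
  have : embI x = embL x := rfl
  rw [inner_split, this, prj_emb, lst_emb, mul_zero, add_zero, real_inner_comm]

lemma trace_integrable (f : 𝓢(EuclideanSpace ℝ (Fin (m+1)), ℂ)) :
    Integrable (traceFn (f : _ → ℂ)) := by
  have := (SchwartzMap.compCLMOfAntilipschitz ℝ (K := 1)
    (embI (m := m)).toContinuousLinearMap.hasTemperateGrowth embI.isometry.antilipschitz f).integrable
      (μ := (volume : Measure (EuclideanSpace ℝ (Fin m))))
  exact this

lemma trace_inversion (f : 𝓢(EuclideanSpace ℝ (Fin (m+1)), ℂ)) (x : EuclideanSpace ℝ (Fin m)) :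
    traceFn (f : _ → ℂ) x = ∫ ξ, ech (inner ℝ x (prj ξ)) * 𝓕 (f : _ → ℂ) ξ := by
  rw [trace_eq]
  conv_lhs => rw [← schwartz_inv_fourier f, fourierInv_eq_ech]
  simp_rw [inner_emb]

lemma schwartz_fourier_integrable (f : 𝓢(EuclideanSpace ℝ (Fin (m+1)), ℂ)) :
    Integrable (𝓕 (f : _ → ℂ)) := by
  rw [← SchwartzMap.fourier_coe]; exact (𝓕 f).integrable

lemma trace_repr {η : ℝ → ℝ} (hη : IsBump η) (j : ℕ)
    (f : 𝓢(EuclideanSpace ℝ (Fin (m+1)), ℂ)) (x : EuclideanSpace ℝ (Fin m)) :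
    dyadicBox η j (traceFn (f : _ → ℂ)) x =
      ∫ ξ, ech (inner ℝ x (prj ξ)) * ((littlewood η j (prj ξ) : ℂ) * 𝓕 (f : _ → ℂ) ξ) := by
  obtain ⟨a, ha⟩ := lw_schwartz hη (d := m) j
  unfold dyadicBox
  simp_rw [← ha]
  rw [fourierInv_eq_ech]
  simp_rw [fourier_eq_ech (traceFn (f : _ → ℂ)), ← mul_assoc]
  rw [fubini_ech (integrable_ech_mul a.integrable (by fun_prop)) (trace_integrable f)
    (B := fun v w => -inner ℝ w v) (by unfold Function.uncurry; fun_prop)]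
  have h1 : ∀ w, (∫ v, ech (-inner ℝ w v) * (ech (inner ℝ v x) * a v)) = 𝓕⁻ (a : _ → ℂ) (x - w) := by
    intro w
    rw [fourierInv_eq_ech]
    congr 1; ext v
    rw [← mul_assoc, ← ech_add, inner_sub_right, real_inner_comm v w]
    congr 2; ring
  simp_rw [h1, trace_inversion]
  rw [fubini_ech ((schwartz_inv_integrable a).comp_sub_left x) (schwartz_fourier_integrable f)
    (B := fun v w => inner ℝ v (prj w))
    (by have := prj_continuous (m := m); unfold Function.uncurry; fun_prop)]
  simp_rw [conv_ech]

/-- The trace pieces. -/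
def Tpc (η : ℝ → ℝ) (j k : ℕ) (f : EuclideanSpace ℝ (Fin (m+1)) → ℂ)
    (x : EuclideanSpace ℝ (Fin m)) : ℂ :=
  ∫ ξ, ech (inner ℝ x (prj ξ)) * ((littlewood η j (prj ξ) : ℂ) * ((littlewood η k ξ : ℂ) * 𝓕 f ξ))

lemma lw_meas {η : ℝ → ℝ} (hη : IsBump η) {d : ℕ} (j : ℕ) :
    Continuous (fun ξ : EuclideanSpace ℝ (Fin d) => (littlewood η j ξ : ℂ)) := by
  obtain ⟨a, ha⟩ := lw_schwartz hη (d := d) j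
  simp_rw [← ha]; exact a.continuous

lemma Tpc_integrable {η : ℝ → ℝ} (hη : IsBump η) (j k : ℕ)
    (f : 𝓢(EuclideanSpace ℝ (Fin (m+1)), ℂ)) :
    Integrable (fun ξ => (littlewood η j (prj ξ) : ℂ) * ((littlewood η k ξ : ℂ) * 𝓕 (f : _ → ℂ) ξ)) := by
  refine (schwartz_fourier_integrable f).mono ?_ ?_
  · exact ((lw_meas hη j).comp prj_continuous).aestronglyMeasurable.mul
      ((lw_meas hη k).aestronglyMeasurable.mul (schwartz_fourier_integrable f).1)
  · filter_upwards with ξ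
    rw [norm_mul, norm_mul, Complex.norm_real, Complex.norm_real, ← mul_assoc]
    refine mul_le_of_le_one_left (norm_nonneg _) ?_
    exact mul_le_one₀ (lw_abs_le hη _ _) (norm_nonneg _) (lw_abs_le hη _ _)

lemma Tpc_continuous {η : ℝ → ℝ} (hη : IsBump η) (j k : ℕ)
    (f : 𝓢(EuclideanSpace ℝ (Fin (m+1)), ℂ)) : Continuous (Tpc η j k (f : _ → ℂ)) := by
  have hi := Tpc_integrable hη j k f
  unfold Tpc
  refine continuous_of_dominated (bound := fun ξ => ‖(littlewood η j (prj ξ) : ℂ) * ((littlewood η k ξ : ℂ) * 𝓕 (f : _ → ℂ) ξ)‖) ?_ ?_ hi.norm ?_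
  · intro x
    exact (integrable_ech_mul hi (by have := prj_continuous (m := m); fun_prop)).1
  · intro x; filter_upwards with ξ; simp [norm_ech]
  · filter_upwards with ξ
    have := ech_continuous
    fun_prop

lemma Tpc_tendsto {η : ℝ → ℝ} (hη : IsBump η) (j : ℕ)
    (f : 𝓢(EuclideanSpace ℝ (Fin (m+1)), ℂ)) (x : EuclideanSpace ℝ (Fin m)) :
    Filter.Tendsto (fun N => ∑ k ∈ Finset.range (N + 1), Tpc η j k (f : _ → ℂ) x) Filter.atTop
      (nhds (dyadicBox η j (traceFn (f : _ → ℂ)) x)) := by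
  have hsum : ∀ N, ∑ k ∈ Finset.range (N + 1), Tpc η j k (f : _ → ℂ) x =
      ∫ ξ, ech (inner ℝ x (prj ξ)) * ((littlewood η j (prj ξ) : ℂ) *
        ((η (((2:ℝ) ^ N)⁻¹ * ‖ξ‖) : ℂ) * 𝓕 (f : _ → ℂ) ξ)) := by
    intro N
    unfold Tpc
    rw [← integral_finsetSum]
    · congr 1; ext ξ
      rw [← lw_sum η N ξ, Complex.ofReal_sum, Finset.sum_mul, Finset.mul_sum, Finset.mul_sum]
    · intro k _
      exact integrable_ech_mul (Tpc_integrable hη j k f) (by have := prj_continuous (m := m); fun_prop)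
  simp_rw [hsum]
  rw [trace_repr hη]
  refine tendsto_integral_of_dominated_convergence (fun ξ => ‖𝓕 (f : _ → ℂ) ξ‖) ?_
    (schwartz_fourier_integrable f).norm ?_ ?_
  · intro N
    have c1 := ech_continuous
    have c2 := prj_continuous (m := m)
    have c3 : Continuous η := hη.1.continuous
    have c4 : Continuous (𝓕 (f : _ → ℂ)) := by
      rw [← SchwartzMap.fourier_coe]; exact (𝓕 f).continuous
    have c5 := lw_meas hη (d := m) j
    apply Continuous.aestronglyMeasurable
    have c6 := c5.comp c2
    simp only [Function.comp_def] at c6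
    fun_prop
  · intro N
    filter_upwards with ξ
    rw [norm_mul, norm_ech, one_mul, norm_mul, norm_mul, Complex.norm_real, Complex.norm_real, ← mul_assoc]
    refine mul_le_of_le_one_left (norm_nonneg _) ?_
    refine mul_le_one₀ (lw_abs_le hη _ _) (norm_nonneg _) ?_
    rw [Real.norm_of_nonneg (hη.2.1 _).1]; exact (hη.2.1 _).2
  · filter_upwards with ξ
    apply tendsto_const_nhds.congr'
    obtain ⟨N0, hN0⟩ := pow_unbounded_of_one_lt ‖ξ‖ (one_lt_two (α := ℝ))
    filter_upwards [Filter.eventually_ge_atTop N0] with N hN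
    rw [hη.2.2.1, Complex.ofReal_one, one_mul]
    rw [abs_of_nonneg (by positivity), ← div_eq_inv_mul, div_le_one (by positivity)]
    exact hN0.le.trans (pow_le_pow_right₀ one_le_two hN)

lemma Tpc_zero {η : ℝ → ℝ} (hη : IsBump η) {j k : ℕ} (hjk : k + 2 ≤ j)
    (f : EuclideanSpace ℝ (Fin (m+1)) → ℂ) (x : EuclideanSpace ℝ (Fin m)) :
    Tpc η j k f x = 0 := by
  unfold Tpc
  rw [← integral_zero]
  congr 1; ext ξ
  by_cases h : (2:ℝ) ^ (k + 1) ≤ ‖ξ‖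
  · rw [lw_zero_large hη k ξ h]; simp
  · obtain ⟨i, rfl⟩ : ∃ i, j = i + 1 := ⟨j - 1, by omega⟩
    rw [lw_zero_small hη i (prj ξ)]
    · simp
    · exact (norm_prj_le ξ).trans ((not_le.1 h).le.trans
        (pow_le_pow_right₀ one_le_two (by omega)))

/-- The product kernel. -/
def Nker (a : EuclideanSpace ℝ (Fin m) → ℂ) (χ : ℝ → ℂ) (x : EuclideanSpace ℝ (Fin m))
    (y : EuclideanSpace ℝ (Fin (m+1))) : ℂ := 𝓕⁻ χ (-lst y) * 𝓕⁻ a (x - prj y)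

lemma Nker_integrable (a : 𝓢(EuclideanSpace ℝ (Fin m), ℂ)) (χ : 𝓢(ℝ, ℂ))
    (x : EuclideanSpace ℝ (Fin m)) : Integrable (Nker (a : _ → ℂ) (χ : _ → ℂ) x) := by
  exact integrable_split (a := fun t => 𝓕⁻ (χ : _ → ℂ) (-t)) (b := fun z => 𝓕⁻ (a : _ → ℂ) (x - z))
    (schwartz_inv_integrable χ).comp_neg ((schwartz_inv_integrable a).comp_sub_left x)

lemma Nker_continuous (a : 𝓢(EuclideanSpace ℝ (Fin m), ℂ)) (χ : 𝓢(ℝ, ℂ)) :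
    Continuous (Function.uncurry (Nker (a : _ → ℂ) (χ : _ → ℂ))) := by
  have h1 := schwartz_inv_continuous a
  have h2 := schwartz_inv_continuous χ
  have h3 := prj_continuous (m := m)
  have h4 := lst_continuous (m := m)
  unfold Nker Function.uncurry
  exact (h2.comp (h4.comp continuous_snd).neg).mul
    (h1.comp (continuous_fst.sub (h3.comp continuous_snd)))

lemma Nker_ft (a : 𝓢(EuclideanSpace ℝ (Fin m), ℂ)) (χ : 𝓢(ℝ, ℂ))
    (x : EuclideanSpace ℝ (Fin m)) (ζ : EuclideanSpace ℝ (Fin (m+1))) :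
    ∫ y, ech (inner ℝ y ζ) * Nker (a : _ → ℂ) (χ : _ → ℂ) x y =
      χ (lst ζ) * (ech (inner ℝ x (prj ζ)) * a (prj ζ)) := by
  have h := integral_split (m := m) (fun t => ech (inner ℝ t (lst ζ)) * 𝓕⁻ (χ : _ → ℂ) (0 - t))
    (fun z => ech (inner ℝ z (prj ζ)) * 𝓕⁻ (a : _ → ℂ) (x - z))
  rw [conv_ech, conv_ech] at h
  simp only [inner_zero_left, ech_zero, one_mul] at h
  rw [← h]
  congr 1; ext y
  rw [inner_split, ech_add, Nker, zero_sub]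
  have : inner ℝ (lst y) (lst ζ) = lst y * lst ζ := by simp [mul_comm]
  rw [this]; ring

lemma hker_ft (a : 𝓢(EuclideanSpace ℝ (Fin m), ℂ)) (χ : 𝓢(ℝ, ℂ))
    (b : 𝓢(EuclideanSpace ℝ (Fin (m+1)), ℂ))
    (x : EuclideanSpace ℝ (Fin m)) (ξ : EuclideanSpace ℝ (Fin (m+1))) :
    𝓕 (fun y => Nker (a : _ → ℂ) (χ : _ → ℂ) x y * 𝓕⁻ (b : _ → ℂ) y) ξ =
      ∫ ζ, (χ (lst (ζ - ξ)) * (ech (inner ℝ x (prj (ζ - ξ))) * a (prj (ζ - ξ)))) * b ζ := by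
  rw [fourier_eq_ech]
  simp_rw [fourierInv_eq_ech (b : _ → ℂ), ← mul_assoc]
  rw [fubini_ech (integrable_ech_mul (Nker_integrable a χ x) (by fun_prop)) b.integrable
    (B := fun v w => inner ℝ w v) (by unfold Function.uncurry; fun_prop)]
  congr 1; ext ζ
  congr 1
  rw [mul_assoc, ← Nker_ft]
  congr 1; ext y
  rw [← mul_assoc, ← ech_add, inner_sub_right, real_inner_comm, sub_eq_add_neg]

lemma hker_integrable (a : 𝓢(EuclideanSpace ℝ (Fin m), ℂ)) (χ : 𝓢(ℝ, ℂ))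
    (b : 𝓢(EuclideanSpace ℝ (Fin (m+1)), ℂ)) (x : EuclideanSpace ℝ (Fin m)) :
    Integrable (fun y => Nker (a : _ → ℂ) (χ : _ → ℂ) x y * 𝓕⁻ (b : _ → ℂ) y) := by
  refine (Nker_integrable a χ x).mul_bdd (c := ∫ v, ‖b v‖) (schwartz_inv_continuous b).aestronglyMeasurable ?_
  filter_upwards with y using norm_fourierInv_le _ _

/-- Summary of the kernel representation. -/
lemma Tpc_kernel {η : ℝ → ℝ} (hη : IsBump η) {j k : ℕ} (hjk : j ≤ k + 1)
    (f : 𝓢(EuclideanSpace ℝ (Fin (m+1)), ℂ)) (χ : 𝓢(ℝ, ℂ))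
    (hχ1 : ∀ t, |t| ≤ 2 ^ (k + 1) → χ t = 1) (hχ0 : ∀ t, 2 ^ (k + 2) ≤ |t| → χ t = 0)
    (x : EuclideanSpace ℝ (Fin m)) :
    let h := fun y => Nker (fun ξ => (littlewood η j ξ : ℂ)) (χ : _ → ℂ) x y *
      dyadicBox η k (f : _ → ℂ) y
    Continuous h ∧ Integrable h ∧ ‖Tpc η j k (f : _ → ℂ) x‖ ≤ ∫ y, ‖h y‖ ∧
      ∀ y, ‖h y‖ ≤ (volume (Metric.closedBall (0 : EuclideanSpace ℝ (Fin (m+1)))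
        (2 ^ (k + 4)))).toReal * ∫ y, ‖h y‖ := by
  obtain ⟨a, ha⟩ := lw_schwartz hη (d := m) j
  obtain ⟨c, hc⟩ := lw_schwartz hη (d := m + 1) k
  have hcs : HasCompactSupport c := by
    refine HasCompactSupport.intro (isCompact_closedBall 0 (2 ^ (k + 1))) ?_
    intro ξ hξ
    rw [mem_closedBall_zero_iff, not_le] at hξ
    rw [hc, lw_zero_large hη k ξ hξ.le, Complex.ofReal_zero]
  obtain ⟨b, hb⟩ := schwartz_mul_schwartz (𝓕 f) c.smooth' hcs
  have hb' : (b : _ → ℂ) = fun ξ => (littlewood η k ξ : ℂ) * 𝓕 (f : _ → ℂ) ξ := by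
    ext ξ; rw [hb, ← SchwartzMap.fourier_coe, ← hc]; rfl
  have hg : dyadicBox η k (f : _ → ℂ) = 𝓕⁻ (b : _ → ℂ) := by rw [hb']; rfl
  have ha' : (fun ξ => (littlewood η j ξ : ℂ)) = (a : EuclideanSpace ℝ (Fin m) → ℂ) :=
    funext fun ξ => (ha ξ).symm
  have hb0 : ∀ ξ, 2 ^ (k + 1) ≤ ‖ξ‖ → b ξ = 0 := by
    intro ξ hξ; rw [congrFun hb' ξ, lw_zero_large hη k ξ hξ]; simp
  rw [hg, ha']
  intro h
  have hcont : Continuous h :=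
    ((Nker_continuous a χ).comp (Continuous.prodMk_right x)).mul (schwartz_inv_continuous b)
  have hintg : Integrable h := hker_integrable a χ b x
  refine ⟨hcont, hintg, ?_, ?_⟩
  · have : Tpc η j k (f : _ → ℂ) x = 𝓕 h 0 := by
      rw [hker_ft]
      unfold Tpc
      congr 1; ext ξ
      rw [sub_zero, ha, ← mul_assoc, ← congrFun hb' ξ]
      by_cases hξ : 2 ^ (k + 1) ≤ ‖ξ‖
      · rw [hb0 ξ hξ]; simp
      · rw [hχ1 _ ((abs_lst_le ξ).trans (not_le.1 hξ).le), one_mul]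
    rw [this]; exact norm_fourier_le _ _
  · refine sup_le_of_fourier_supp hcont hintg ?_
    intro ξ hξ
    rw [hker_ft, ← integral_zero]
    congr 1; ext ζ
    by_cases h1 : 2 ^ (k + 1) ≤ ‖ζ‖
    · rw [hb0 ζ h1, mul_zero]
    by_cases h2 : 2 ^ (k + 2) ≤ |lst (ζ - ξ)|
    · rw [hχ0 _ h2]; simp
    by_cases h3 : 2 ^ (j + 1) ≤ ‖prj (ζ - ξ)‖
    · rw [ha, lw_zero_large hη j _ h3]; simp
    exfalso
    push Not at h1 h2 h3
    have e1 := norm_le_split (ζ - ξ)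
    have e2 : ‖ξ‖ ≤ ‖ζ‖ + ‖ζ - ξ‖ := by
      have := norm_sub_le ζ (ζ - ξ); rwa [sub_sub_cancel] at this
    have e3 : (2:ℝ) ^ (j + 1) ≤ 2 ^ (k + 2) := pow_le_pow_right₀ one_le_two (by omega)
    have e4 : (0:ℝ) < 2 ^ k := by positivity
    simp only [pow_succ] at *
    linarith

end Part3

section Part4
open MeasureTheory FourierTransform
open scoped ENNReal NNReal SchwartzMap

/-- Nikolskii-type inequality. -/
lemma nikolskii_aux {α : Type*} [MeasurableSpace α] {μ : Measure α} {u : α → ℝ≥0∞}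
    {v : ℝ≥0∞} {r : ℝ} (hr : 0 < r) (hr1 : r ≤ 1) (hI : ∫⁻ y, u y ∂μ ≠ ∞)
    (hv : v ≠ ∞) (hu : ∀ y, u y ≤ v * ∫⁻ y, u y ∂μ) :
    (∫⁻ y, u y ∂μ) ^ r ≤ v ^ (1 - r) * ∫⁻ y, u y ^ r ∂μ := by
  set I := ∫⁻ y, u y ∂μ with hIdef
  by_cases h0 : I = 0
  · rw [h0, ENNReal.zero_rpow_of_pos hr]; exact zero_le
  have h1 : I ≤ (v * I) ^ (1 - r) * ∫⁻ y, u y ^ r ∂μ := by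
    rw [← lintegral_const_mul' _ _
      (ENNReal.rpow_ne_top_of_nonneg (by linarith) (ENNReal.mul_ne_top hv hI))]
    conv_lhs => rw [hIdef]
    refine lintegral_mono fun y => ?_
    have hy : u y ≠ ∞ := ((hu y).trans_lt (ENNReal.mul_lt_top hv.lt_top hI.lt_top)).ne
    calc u y = u y ^ (1 - r) * u y ^ r := by
          by_cases hy0 : u y = 0
          · rw [hy0, ENNReal.zero_rpow_of_pos hr, mul_zero]
          · rw [← ENNReal.rpow_add _ _ hy0 hy]; simp
      _ ≤ _ := mul_le_mul' (ENNReal.rpow_le_rpow (hu y) (by linarith)) le_rfl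
  rw [ENNReal.mul_rpow_of_nonneg _ _ (by linarith)] at h1
  have h2 : I = I ^ r * I ^ (1 - r) := by
    rw [← ENNReal.rpow_add _ _ h0 hI]; simp
  have hne : I ^ (1 - r) ≠ 0 := by simp [ENNReal.rpow_eq_zero_iff, h0, hI]
  have hnt : I ^ (1 - r) ≠ ∞ := ENNReal.rpow_ne_top_of_nonneg (by linarith) hI
  have h3 : I ^ r * I ^ (1 - r) ≤ (v ^ (1 - r) * ∫⁻ y, u y ^ r ∂μ) * I ^ (1 - r) := by
    rw [← h2]; refine h1.trans (le_of_eq ?_); ring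
  exact (ENNReal.mul_le_mul_iff_left hne hnt).1 h3

lemma jensen_aux {α : Type*} [MeasurableSpace α] {μ : Measure α} {w g : α → ℝ≥0∞}
    (hw : AEMeasurable w μ) (hg : AEMeasurable g μ) {r : ℝ} (hr : 1 ≤ r) (hwt : ∀ y, w y ≠ ∞) :
    (∫⁻ y, w y * g y ∂μ) ^ r ≤ (∫⁻ y, w y ∂μ) ^ (r - 1) * ∫⁻ y, w y * g y ^ r ∂μ := by
  have hr0 : 0 < r := by linarith
  have h := ENNReal.lintegral_mul_norm_pow_le (μ := μ) hw (hw.mul (hg.pow_const r))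
    (p := 1 - 1 / r) (q := 1 / r) (by rw [sub_nonneg, div_le_one hr0]; exact hr) (by positivity)
    (by ring)
  have e : ∀ y, w y ^ (1 - 1 / r) * (w * fun y => g y ^ r) y ^ (1 / r) = w y * g y := by
    intro y
    rw [Pi.mul_apply, ENNReal.mul_rpow_of_nonneg _ _ (by positivity), ← ENNReal.rpow_mul,
      mul_one_div_cancel hr0.ne', ENNReal.rpow_one, ← mul_assoc]
    congr 1
    by_cases h0 : w y = 0
    · rw [h0, ENNReal.zero_rpow_of_pos (y := 1 / r) (by positivity), mul_zero]
    · rw [← ENNReal.rpow_add _ _ h0 (hwt y)]; simp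
  simp_rw [e] at h
  have h2 := ENNReal.rpow_le_rpow h hr0.le
  refine h2.trans (le_of_eq ?_)
  rw [ENNReal.mul_rpow_of_nonneg _ _ hr0.le, ← ENNReal.rpow_mul, ← ENNReal.rpow_mul,
    one_div_mul_cancel hr0.ne', ENNReal.rpow_one, sub_mul, one_div_mul_cancel hr0.ne', one_mul]
  rfl

variable {m : ℕ}

lemma swap_bound (a : 𝓢(EuclideanSpace ℝ (Fin m), ℂ)) (χ : 𝓢(ℝ, ℂ)) {S : ℝ≥0∞}
    (hS : ∀ t, ‖𝓕⁻ (χ : _ → ℂ) t‖ₑ ≤ S) {r : ℝ} (hr : 0 < r)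
    {F : EuclideanSpace ℝ (Fin (m+1)) → ℝ≥0∞} (hF : Measurable F) :
    ∫⁻ x, ∫⁻ y, ‖Nker (a : _ → ℂ) (χ : _ → ℂ) x y‖ₑ ^ r * F y ≤
      S ^ r * (∫⁻ x, ‖𝓕⁻ (a : _ → ℂ) x‖ₑ ^ r) * ∫⁻ y, F y := by
  rw [lintegral_lintegral_swap]
  · rw [← lintegral_const_mul _ hF]
    refine lintegral_mono fun y => ?_
    have hm : Measurable fun x => ‖𝓕⁻ (a : _ → ℂ) x‖ₑ ^ r :=
      ((schwartz_inv_continuous a).measurable.enorm).pow_const r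
    calc ∫⁻ x, ‖Nker (a : _ → ℂ) (χ : _ → ℂ) x y‖ₑ ^ r * F y
        ≤ ∫⁻ x, (S ^ r * F y) * ‖𝓕⁻ (a : _ → ℂ) (x - prj y)‖ₑ ^ r := by
          refine lintegral_mono fun x => ?_
          simp only [Nker]
          rw [enorm_mul, ENNReal.mul_rpow_of_nonneg _ _ hr.le]
          have : ‖𝓕⁻ (χ : _ → ℂ) (-lst y)‖ₑ ^ r ≤ S ^ r := ENNReal.rpow_le_rpow (hS _) hr.le
          calc _ ≤ S ^ r * ‖𝓕⁻ (a : _ → ℂ) (x - prj y)‖ₑ ^ r * F y := by gcongr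
            _ = _ := by ring
      _ = (S ^ r * F y) * ∫⁻ x, ‖𝓕⁻ (a : _ → ℂ) (x - prj y)‖ₑ ^ r := by
          rw [lintegral_const_mul]
          exact hm.comp (measurable_id.sub_const _)
      _ = (S ^ r * F y) * ∫⁻ x, ‖𝓕⁻ (a : _ → ℂ) x‖ₑ ^ r := by
          rw [lintegral_sub_right_eq_self (fun x => ‖𝓕⁻ (a : _ → ℂ) x‖ₑ ^ r)]
      _ = _ := by ring
      _ ≤ _ := le_rfl
  · exact (((Nker_continuous a χ).measurable.enorm.pow_const r).mul
      (hF.comp measurable_snd)).aemeasurable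

lemma dyadic_continuous {η : ℝ → ℝ} (hη : IsBump η) (k : ℕ)
    (f : 𝓢(EuclideanSpace ℝ (Fin (m+1)), ℂ)) : Continuous (dyadicBox η k (f : _ → ℂ)) := by
  obtain ⟨c, hc⟩ := lw_schwartz hη (d := m + 1) k
  have hcs : HasCompactSupport c := by
    refine HasCompactSupport.intro (isCompact_closedBall 0 (2 ^ (k + 1))) ?_
    intro ξ hξ
    rw [mem_closedBall_zero_iff, not_le] at hξ
    rw [hc, lw_zero_large hη k ξ hξ.le, Complex.ofReal_zero]
  obtain ⟨b, hb⟩ := schwartz_mul_schwartz (𝓕 f) c.smooth' hcs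
  have hb' : (b : _ → ℂ) = fun ξ => (littlewood η k ξ : ℂ) * 𝓕 (f : _ → ℂ) ξ := by
    ext ξ; rw [hb, ← SchwartzMap.fourier_coe, ← hc]; rfl
  have hg : dyadicBox η k (f : _ → ℂ) = 𝓕⁻ (b : _ → ℂ) := by rw [hb']; rfl
  rw [hg]; exact schwartz_inv_continuous b

/-- ENNReal version of `Tpc_kernel`. -/
lemma Tpc_kernel' {η : ℝ → ℝ} (hη : IsBump η) {j k : ℕ} (hjk : j ≤ k + 1)
    (f : 𝓢(EuclideanSpace ℝ (Fin (m+1)), ℂ)) (χ : 𝓢(ℝ, ℂ))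
    (hχ1 : ∀ t, |t| ≤ 2 ^ (k + 1) → χ t = 1) (hχ0 : ∀ t, 2 ^ (k + 2) ≤ |t| → χ t = 0)
    (x : EuclideanSpace ℝ (Fin m)) :
    let u := fun y => ‖Nker (fun ξ => (littlewood η j ξ : ℂ)) (χ : _ → ℂ) x y‖ₑ *
      ‖dyadicBox η k (f : _ → ℂ) y‖ₑ
    ∫⁻ y, u y ≠ ∞ ∧ ‖Tpc η j k (f : _ → ℂ) x‖ₑ ≤ ∫⁻ y, u y ∧
      ∀ y, u y ≤ volume (Metric.closedBall (0 : EuclideanSpace ℝ (Fin (m+1)))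
        (2 ^ (k + 4))) * ∫⁻ y, u y := by
  intro u
  obtain ⟨_, h2, h3, h4⟩ := Tpc_kernel hη hjk f χ hχ1 hχ0 x
  simp only at h2 h3 h4
  have hu : ∀ y, u y = ‖Nker (fun ξ => (littlewood η j ξ : ℂ)) (χ : _ → ℂ) x y *
      dyadicBox η k (f : _ → ℂ) y‖ₑ := fun y => (enorm_mul _ _).symm
  have hI : ∫⁻ y, u y = ENNReal.ofReal (∫ y, ‖Nker (fun ξ => (littlewood η j ξ : ℂ)) (χ : _ → ℂ) x y *
      dyadicBox η k (f : _ → ℂ) y‖) := by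
    simp_rw [hu]; rw [ofReal_integral_norm_eq_lintegral_enorm h2]
  rw [hI]
  refine ⟨ENNReal.ofReal_ne_top, ?_, ?_⟩
  · rw [← ofReal_norm]; exact ENNReal.ofReal_le_ofReal h3
  · intro y
    have hv : volume (Metric.closedBall (0 : EuclideanSpace ℝ (Fin (m+1))) (2 ^ (k + 4))) ≠ ∞ :=
      (isCompact_closedBall _ _).measure_lt_top.ne
    rw [hu, ← ofReal_norm, ← ENNReal.ofReal_toReal hv, ← ENNReal.ofReal_mul (by positivity)]
    exact ENNReal.ofReal_le_ofReal (h4 y)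

lemma Nker_l1 (a : 𝓢(EuclideanSpace ℝ (Fin m), ℂ)) (χ : 𝓢(ℝ, ℂ))
    (x : EuclideanSpace ℝ (Fin m)) :
    ∫⁻ y, ‖Nker (a : _ → ℂ) (χ : _ → ℂ) x y‖ₑ =
      (∫⁻ t, ‖𝓕⁻ (χ : _ → ℂ) t‖ₑ) * ∫⁻ z, ‖𝓕⁻ (a : _ → ℂ) z‖ₑ := by
  have h1 := (schwartz_inv_continuous a).measurable.enorm
  have h2 := (schwartz_inv_continuous χ).measurable.enorm
  have := lintegral_split (m := m) (a := fun t => ‖𝓕⁻ (χ : _ → ℂ) (-t)‖ₑ)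
    (b := fun z => ‖𝓕⁻ (a : _ → ℂ) (x - z)‖ₑ) (h2.comp measurable_neg).aemeasurable
    (h1.comp (measurable_const.sub measurable_id)).aemeasurable
  simp only [Nker, enorm_mul]
  rw [this, lintegral_sub_left_eq_self (fun z => ‖𝓕⁻ (a : _ → ℂ) z‖ₑ),
    lintegral_neg_eq_self (fun z => ‖𝓕⁻ (χ : _ → ℂ) z‖ₑ)]

/-- The case `p ≤ 1`. -/
lemma Tpc_bound_le_one {η : ℝ → ℝ} (hη : IsBump η) {r : ℝ} (hr : 0 < r) (hr1 : r ≤ 1) :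
    ∃ C : ℝ≥0∞, C ≠ ∞ ∧ ∀ (j k : ℕ), j ≤ k + 1 →
      ∀ f : 𝓢(EuclideanSpace ℝ (Fin (m+1)), ℂ),
      ∫⁻ x, ‖Tpc η j k (f : _ → ℂ) x‖ₑ ^ r ≤
        C * ENNReal.ofReal ((2:ℝ) ^ (((k:ℝ) - j) * (m * (1 - r)) + k)) *
          ∫⁻ y, ‖dyadicBox η k (f : _ → ℂ) y‖ₑ ^ r := by
  obtain ⟨D, hD, hK⟩ := lw_kernel_bound hη m hr
  obtain ⟨_, _, hχ⟩ := chi_exists hη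
  set v1 := volume (Metric.ball (0 : EuclideanSpace ℝ (Fin (m+1))) 1) with hv1
  have hv1t : v1 ≠ ∞ := measure_ball_lt_top.ne
  refine ⟨v1 ^ (1 - r) * D * ENNReal.ofReal ((2:ℝ) ^ (4 * ((m + 1) * (1 - r)) + 3 * r)), ?_, ?_⟩
  · exact ENNReal.mul_ne_top (ENNReal.mul_ne_top
      (ENNReal.rpow_ne_top_of_nonneg (by linarith) hv1t) hD) (by simp)
  intro j k hjk f
  obtain ⟨χ, h1, h0, _, hS⟩ := hχ k
  obtain ⟨a, ha⟩ := lw_schwartz hη (d := m) j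
  have ha' : (fun ξ => (littlewood η j ξ : ℂ)) = (a : EuclideanSpace ℝ (Fin m) → ℂ) :=
    funext fun ξ => (ha ξ).symm
  have hKj := hK j
  have hk := Tpc_kernel' hη hjk f χ h1 h0
  rw [ha'] at hKj hk
  have hGm : Measurable fun y => ‖dyadicBox η k (f : _ → ℂ) y‖ₑ ^ r :=
    (dyadic_continuous hη k f).measurable.enorm.pow_const r
  set v := volume (Metric.closedBall (0 : EuclideanSpace ℝ (Fin (m+1))) (2 ^ (k + 4))) with hv
  have hvt : v ≠ ∞ := (isCompact_closedBall _ _).measure_lt_top.ne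
  have hve : v = ENNReal.ofReal ((2:ℝ) ^ (((k:ℝ) + 4) * (m + 1))) * v1 := by
    rw [hv, Measure.addHaar_closedBall _ _ (by positivity), finrank_euclideanSpace_fin, ← pow_mul,
      ← Real.rpow_natCast]
    push_cast; rfl
  calc ∫⁻ x, ‖Tpc η j k (f : _ → ℂ) x‖ₑ ^ r
      ≤ ∫⁻ x, v ^ (1 - r) * ∫⁻ y, ‖Nker (a : _ → ℂ) (χ : _ → ℂ) x y‖ₑ ^ r *
          ‖dyadicBox η k (f : _ → ℂ) y‖ₑ ^ r := by
        refine lintegral_mono fun x => ?_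
        obtain ⟨e1, e2, e3⟩ := hk x
        refine (ENNReal.rpow_le_rpow e2 hr.le).trans ?_
        refine (nikolskii_aux hr hr1 e1 hvt e3).trans (le_of_eq ?_)
        simp_rw [ENNReal.mul_rpow_of_nonneg _ _ hr.le]
    _ = v ^ (1 - r) * ∫⁻ x, ∫⁻ y, ‖Nker (a : _ → ℂ) (χ : _ → ℂ) x y‖ₑ ^ r *
          ‖dyadicBox η k (f : _ → ℂ) y‖ₑ ^ r := by
        rw [lintegral_const_mul' _ _ (ENNReal.rpow_ne_top_of_nonneg (by linarith) hvt)]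
    _ ≤ v ^ (1 - r) * (ENNReal.ofReal (2 ^ (k + 3)) ^ r *
          (D * ENNReal.ofReal ((2:ℝ) ^ ((j:ℝ) * (m * (r - 1))))) *
          ∫⁻ y, ‖dyadicBox η k (f : _ → ℂ) y‖ₑ ^ r) := by
        gcongr
        refine (swap_bound a χ hS hr hGm).trans ?_
        gcongr
    _ = (v1 ^ (1 - r) * D) * (ENNReal.ofReal ((2:ℝ) ^ (((k:ℝ) + 4) * (m + 1))) ^ (1 - r) *
          ENNReal.ofReal (2 ^ (k + 3)) ^ r * ENNReal.ofReal ((2:ℝ) ^ ((j:ℝ) * (m * (r - 1))))) *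
          ∫⁻ y, ‖dyadicBox η k (f : _ → ℂ) y‖ₑ ^ r := by
        rw [hve, ENNReal.mul_rpow_of_nonneg _ _ (by linarith)]; ring
    _ = _ := by
        congr 1
        rw [mul_assoc (v1 ^ (1 - r) * D) (ENNReal.ofReal _)]
        congr 1
        rw [ENNReal.ofReal_rpow_of_nonneg (by positivity) (by linarith),
          ENNReal.ofReal_rpow_of_nonneg (by positivity) (by linarith),
          ← ENNReal.ofReal_mul (by positivity), ← ENNReal.ofReal_mul (by positivity),
          ← ENNReal.ofReal_mul (by positivity), ← Real.rpow_natCast,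
          ← Real.rpow_mul (by norm_num), ← Real.rpow_mul (by norm_num),
          ← Real.rpow_add (by norm_num), ← Real.rpow_add (by norm_num),
          ← Real.rpow_add (by norm_num)]
        congr 2
        push_cast; ring

/-- The case `1 ≤ p < ∞`. -/
lemma Tpc_bound_ge_one {η : ℝ → ℝ} (hη : IsBump η) {r : ℝ} (hr1 : 1 ≤ r) :
    ∃ C : ℝ≥0∞, C ≠ ∞ ∧ ∀ (j k : ℕ), j ≤ k + 1 →
      ∀ f : 𝓢(EuclideanSpace ℝ (Fin (m+1)), ℂ),
      ∫⁻ x, ‖Tpc η j k (f : _ → ℂ) x‖ₑ ^ r ≤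
        C * ENNReal.ofReal ((2:ℝ) ^ (k:ℝ)) * ∫⁻ y, ‖dyadicBox η k (f : _ → ℂ) y‖ₑ ^ r := by
  have hr : 0 < r := by linarith
  obtain ⟨D, hD, hK⟩ := lw_kernel_bound hη m one_pos
  obtain ⟨E, hE, hχ⟩ := chi_exists hη
  refine ⟨(E * D) ^ (r - 1) * D * 8, ?_, ?_⟩
  · exact ENNReal.mul_ne_top (ENNReal.mul_ne_top
      (ENNReal.rpow_ne_top_of_nonneg (by linarith) (ENNReal.mul_ne_top hE hD)) hD) (by simp)
  intro j k hjk f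
  obtain ⟨χ, h1, h0, hL, hS⟩ := hχ k
  obtain ⟨a, ha⟩ := lw_schwartz hη (d := m) j
  have ha' : (fun ξ => (littlewood η j ξ : ℂ)) = (a : EuclideanSpace ℝ (Fin m) → ℂ) :=
    funext fun ξ => (ha ξ).symm
  have hKj := hK j
  have hk := Tpc_kernel' hη hjk f χ h1 h0
  rw [ha'] at hKj hk
  have hGc := (dyadic_continuous hη k f).measurable.enorm
  have hGm := hGc.pow_const r
  have hsw := swap_bound a χ hS one_pos hGm
  simp only [ENNReal.rpow_one, sub_self, mul_zero, Real.rpow_zero, ENNReal.ofReal_one,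
    mul_one] at hKj hsw
  have hND : ∀ x, ∫⁻ y, ‖Nker (a : _ → ℂ) (χ : _ → ℂ) x y‖ₑ ≤ E * D := by
    intro x; rw [Nker_l1]; gcongr
  calc ∫⁻ x, ‖Tpc η j k (f : _ → ℂ) x‖ₑ ^ r
      ≤ ∫⁻ x, (E * D) ^ (r - 1) * ∫⁻ y, ‖Nker (a : _ → ℂ) (χ : _ → ℂ) x y‖ₑ *
          ‖dyadicBox η k (f : _ → ℂ) y‖ₑ ^ r := by
        refine lintegral_mono fun x => ?_
        obtain ⟨e1, e2, e3⟩ := hk x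
        refine (ENNReal.rpow_le_rpow e2 hr.le).trans ?_
        refine (jensen_aux (((Nker_continuous a χ).comp
          (Continuous.prodMk_right x)).measurable.enorm.aemeasurable) hGc.aemeasurable hr1
          (fun y => enorm_ne_top)).trans ?_
        exact mul_le_mul' (ENNReal.rpow_le_rpow (hND x) (by linarith)) le_rfl
    _ = (E * D) ^ (r - 1) * ∫⁻ x, ∫⁻ y, ‖Nker (a : _ → ℂ) (χ : _ → ℂ) x y‖ₑ *
          ‖dyadicBox η k (f : _ → ℂ) y‖ₑ ^ r := by
        rw [lintegral_const_mul' _ _ (ENNReal.rpow_ne_top_of_nonneg (by linarith)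
          (ENNReal.mul_ne_top hE hD))]
    _ ≤ (E * D) ^ (r - 1) * (ENNReal.ofReal (2 ^ (k + 3)) * D *
          ∫⁻ y, ‖dyadicBox η k (f : _ → ℂ) y‖ₑ ^ r) := by
        gcongr
        refine hsw.trans ?_
        gcongr
    _ = _ := by
        rw [pow_add, ENNReal.ofReal_mul (by positivity), Real.rpow_natCast]
        have : ENNReal.ofReal (2 ^ 3) = 8 := by norm_num
        rw [this]; ring

/-- The case `p = ∞`. -/
lemma Tpc_bound_top {η : ℝ → ℝ} (hη : IsBump η) :
    ∃ C : ℝ≥0∞, C ≠ ∞ ∧ ∀ (j k : ℕ), j ≤ k + 1 →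
      ∀ f : 𝓢(EuclideanSpace ℝ (Fin (m+1)), ℂ),
      eLpNorm (Tpc η j k (f : _ → ℂ)) ∞ volume ≤
        C * eLpNorm (dyadicBox η k (f : _ → ℂ)) ∞ volume := by
  obtain ⟨D, hD, hK⟩ := lw_kernel_bound hη m one_pos
  obtain ⟨E, hE, hχ⟩ := chi_exists hη
  refine ⟨E * D, ENNReal.mul_ne_top hE hD, ?_⟩
  intro j k hjk f
  obtain ⟨χ, h1, h0, hL, hS⟩ := hχ k
  obtain ⟨a, ha⟩ := lw_schwartz hη (d := m) j
  have ha' : (fun ξ => (littlewood η j ξ : ℂ)) = (a : EuclideanSpace ℝ (Fin m) → ℂ) :=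
    funext fun ξ => (ha ξ).symm
  have hKj := hK j
  have hk := Tpc_kernel' hη hjk f χ h1 h0
  rw [ha'] at hKj hk
  simp only [ENNReal.rpow_one, sub_self, mul_zero, Real.rpow_zero, ENNReal.ofReal_one,
    mul_one] at hKj
  have hND : ∀ x, ∫⁻ y, ‖Nker (a : _ → ℂ) (χ : _ → ℂ) x y‖ₑ ≤ E * D := by
    intro x; rw [Nker_l1]; gcongr
  rw [eLpNorm_exponent_top, eLpNorm_exponent_top]
  refine eLpNormEssSup_le_of_ae_enorm_bound (Filter.Eventually.of_forall fun x => ?_)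
  refine (hk x).2.1.trans ?_
  calc _ ≤ ∫⁻ y, ‖Nker (a : _ → ℂ) (χ : _ → ℂ) x y‖ₑ *
        eLpNormEssSup (dyadicBox η k (f : _ → ℂ)) volume := by
        refine lintegral_mono_ae ?_
        filter_upwards [enorm_ae_le_eLpNormEssSup (dyadicBox η k (f : _ → ℂ)) volume] with y hy
        gcongr
    _ = (∫⁻ y, ‖Nker (a : _ → ℂ) (χ : _ → ℂ) x y‖ₑ) *
        eLpNormEssSup (dyadicBox η k (f : _ → ℂ)) volume := by
        rw [lintegral_mul_const]
        exact ((Nker_continuous a χ).comp (Continuous.prodMk_right x)).measurable.enorm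
    _ ≤ _ := by gcongr; exact hND x

lemma root_bound {r s t : ℝ} (hr : 0 < r) {X Y C : ℝ≥0∞} {j k : ℕ}
    (h : X ≤ C * ENNReal.ofReal ((2:ℝ) ^ (((k:ℝ) - j) * (s * r) + k)) * Y) (ht : t = s + 1 / r) :
    ENNReal.ofReal ((2:ℝ) ^ ((j:ℝ) * s)) * X ^ (1 / r) ≤
      C ^ (1 / r) * (ENNReal.ofReal ((2:ℝ) ^ ((k:ℝ) * t)) * Y ^ (1 / r)) := by
  have h2 := ENNReal.rpow_le_rpow h (by positivity : 0 ≤ 1 / r)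
  rw [ENNReal.mul_rpow_of_nonneg _ _ (by positivity), ENNReal.mul_rpow_of_nonneg _ _ (by positivity),
    ENNReal.ofReal_rpow_of_nonneg (by positivity) (by positivity), ← Real.rpow_mul (by norm_num)] at h2
  calc _ ≤ ENNReal.ofReal ((2:ℝ) ^ ((j:ℝ) * s)) * (C ^ (1 / r) *
        ENNReal.ofReal ((2:ℝ) ^ ((((k:ℝ) - j) * (s * r) + k) * (1 / r))) * Y ^ (1 / r)) := by gcongr
    _ = C ^ (1 / r) * ((ENNReal.ofReal ((2:ℝ) ^ ((j:ℝ) * s)) *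
        ENNReal.ofReal ((2:ℝ) ^ ((((k:ℝ) - j) * (s * r) + k) * (1 / r)))) * Y ^ (1 / r)) := by ring
    _ = _ := by
      rw [← ENNReal.ofReal_mul (by positivity), ← Real.rpow_add (by norm_num)]
      congr 4
      rw [ht]; field_simp; ring

/-- Combined bound. -/
lemma Tpc_bound {η : ℝ → ℝ} (hη : IsBump η) (p : ℝ≥0∞) (hp : 0 < p) (sp : ℝ)
    (hsp : sp = m * (1 / (min p 1).toReal - 1)) :
    ∃ C : ℝ≥0∞, C ≠ ∞ ∧ ∀ (j k : ℕ), j ≤ k + 1 →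
      ∀ f : 𝓢(EuclideanSpace ℝ (Fin (m+1)), ℂ),
      ENNReal.ofReal ((2:ℝ) ^ ((j:ℝ) * sp)) * eLpNorm (Tpc η j k (f : _ → ℂ)) p volume ≤
        C * (ENNReal.ofReal ((2:ℝ) ^ ((k:ℝ) * (sp + 1 / p.toReal))) *
          eLpNorm (dyadicBox η k (f : _ → ℂ)) p volume) := by
  by_cases hpt : p = ∞
  · subst hpt
    have : sp = 0 := by rw [hsp]; simp
    subst this
    obtain ⟨C, hC, h⟩ := Tpc_bound_top (m := m) hη
    refine ⟨C, hC, fun j k hjk f => ?_⟩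
    simpa using h j k hjk f
  have hr : 0 < p.toReal := ENNReal.toReal_pos hp.ne' hpt
  simp_rw [eLpNorm_eq_lintegral_rpow_enorm_toReal hp.ne' hpt]
  rcases le_total p 1 with h1 | h1
  · have hr1 : p.toReal ≤ 1 := by simpa using ENNReal.toReal_mono (by simp) h1
    obtain ⟨C, hC, h⟩ := Tpc_bound_le_one (m := m) hη hr hr1
    rw [min_eq_left h1] at hsp
    refine ⟨C ^ (1 / p.toReal), ENNReal.rpow_ne_top_of_nonneg (by positivity) hC,
      fun j k hjk f => root_bound hr ?_ rfl⟩
    have : sp * p.toReal = m * (1 - p.toReal) := by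
      rw [hsp]; field_simp
    rw [this]; exact h j k hjk f
  · have hr1 : 1 ≤ p.toReal := by simpa using ENNReal.toReal_mono hpt h1
    obtain ⟨C, hC, h⟩ := Tpc_bound_ge_one (m := m) hη hr1
    rw [min_eq_right h1] at hsp
    refine ⟨C ^ (1 / p.toReal), ENNReal.rpow_ne_top_of_nonneg (by positivity) hC,
      fun j k hjk f => root_bound hr ?_ rfl⟩
    have : sp = 0 := by rw [hsp]; simp
    rw [this, zero_mul, mul_zero, zero_add]; exact h j k hjk f

end Part4

section Part5
open MeasureTheory FourierTransform
open scoped ENNReal NNReal SchwartzMap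

lemma eLpNorm_rho_add {α : Type*} [MeasurableSpace α] {μ : Measure α} {p : ℝ≥0∞} (hp : 0 < p)
    {ρ : ℝ} (hρ : 0 < ρ) (hρ1 : ρ ≤ 1) (hρp : p ≠ ∞ → ρ ≤ p.toReal) {f g : α → ℂ}
    (hf : AEStronglyMeasurable f μ) (hg : AEStronglyMeasurable g μ) :
    eLpNorm (f + g) p μ ^ ρ ≤ eLpNorm f p μ ^ ρ + eLpNorm g p μ ^ ρ := by
  rcases le_total 1 p with h1 | h1
  · exact (ENNReal.rpow_le_rpow (eLpNorm_add_le hf hg h1) hρ.le).trans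
      (ENNReal.rpow_add_le_add_rpow _ _ hρ.le hρ1)
  · have hpt : p ≠ ∞ := (h1.trans_lt ENNReal.one_lt_top).ne
    have hr : 0 < p.toReal := ENNReal.toReal_pos hp.ne' hpt
    have hr1 : p.toReal ≤ 1 := by simpa using ENNReal.toReal_mono (by simp) h1
    simp_rw [eLpNorm_eq_lintegral_rpow_enorm_toReal hp.ne' hpt, ← ENNReal.rpow_mul]
    have he : 0 ≤ 1 / p.toReal * ρ := by positivity
    have he1 : 1 / p.toReal * ρ ≤ 1 := by
      rw [one_div_mul_eq_div, div_le_one hr]; exact hρp hpt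
    refine le_trans (ENNReal.rpow_le_rpow ?_ he) (ENNReal.rpow_add_le_add_rpow _ _ he he1)
    rw [← lintegral_add_left' (hf.enorm.pow_const _)]
    refine lintegral_mono fun x => ?_
    exact (ENNReal.rpow_le_rpow (enorm_add_le _ _) hr.le).trans
      (ENNReal.rpow_add_le_add_rpow _ _ hr.le hr1)

lemma eLpNorm_rho_sum {α : Type*} [MeasurableSpace α] {μ : Measure α} {p : ℝ≥0∞} (hp : 0 < p)
    {ρ : ℝ} (hρ : 0 < ρ) (hρ1 : ρ ≤ 1) (hρp : p ≠ ∞ → ρ ≤ p.toReal) {f : ℕ → α → ℂ}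
    (hf : ∀ k, AEStronglyMeasurable (f k) μ) (N : ℕ) :
    eLpNorm (∑ k ∈ Finset.range N, f k) p μ ^ ρ ≤
      ∑ k ∈ Finset.range N, eLpNorm (f k) p μ ^ ρ := by
  induction N with
  | zero => simp [hρ]
  | succ N ih =>
    rw [Finset.sum_range_succ, Finset.sum_range_succ]
    refine (eLpNorm_rho_add hp hρ hρ1 hρp
      (Finset.aestronglyMeasurable_sum _ fun i _ => hf i) (hf N)).trans ?_
    gcongr

lemma lqSum_le_rho {q : ℝ≥0∞} {ρ : ℝ} (hρ : 0 < ρ) (hρq : q ≠ ∞ → ρ ≤ q.toReal)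
    (A : ℕ → ℝ≥0∞) : lqSum q A ≤ (∑' j, A j ^ ρ) ^ (1 / ρ) := by
  have hA : ∀ j, A j ≤ (∑' j, A j ^ ρ) ^ (1 / ρ) := by
    intro j
    rw [one_div, ENNReal.le_rpow_inv_iff hρ]
    exact ENNReal.le_tsum (f := fun j => A j ^ ρ) j
  unfold lqSum
  split_ifs with h
  · exact iSup_le hA
  · have hq := hρq h
    have hq0 : 0 < q.toReal := hρ.trans_le hq
    set S := ∑' j, A j ^ ρ with hS
    rw [one_div, ENNReal.rpow_inv_le_iff hq0, ← ENNReal.rpow_mul]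
    have h1 : ∀ j, A j ^ q.toReal ≤ S ^ (1 / ρ * (q.toReal - ρ)) * A j ^ ρ := by
      intro j
      calc A j ^ q.toReal = A j ^ (q.toReal - ρ) * A j ^ ρ := by
            rw [← ENNReal.rpow_add_of_nonneg _ _ (by linarith) hρ.le]; simp
        _ ≤ _ := by
            rw [ENNReal.rpow_mul]
            exact mul_le_mul' (ENNReal.rpow_le_rpow (hA j) (by linarith)) le_rfl
    calc _ ≤ ∑' j, S ^ (1 / ρ * (q.toReal - ρ)) * A j ^ ρ := ENNReal.tsum_le_tsum h1
      _ = S ^ (1 / ρ * (q.toReal - ρ)) * S ^ (1:ℝ) := by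
        rw [ENNReal.tsum_mul_left, ENNReal.rpow_one]
      _ = _ := by
        rw [← ENNReal.rpow_add_of_nonneg _ _
          (mul_nonneg (by positivity) (by linarith)) zero_le_one]
        congr 1; field_simp; ring

lemma sum_swap (B : ℕ → ℝ≥0∞) (c : ℝ≥0∞) :
    ∑' j : ℕ, ∑' k : ℕ, (if j ≤ k + 1 then c * B k else 0) ≤
      2 * c * ∑' k : ℕ, (1 + (k:ℝ≥0∞)) * B k := by
  rw [ENNReal.tsum_comm, ← ENNReal.tsum_mul_left]
  refine ENNReal.tsum_le_tsum fun k => ?_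
  rw [tsum_eq_sum (s := Finset.range (k + 2)) (by
    intro j hj; rw [Finset.mem_range] at hj; rw [if_neg (by omega)])]
  calc _ ≤ ∑ j ∈ Finset.range (k + 2), c * B k := by
        refine Finset.sum_le_sum fun j _ => ?_
        split_ifs <;> simp
    _ = ((k:ℝ≥0∞) + 2) * (c * B k) := by simp
    _ ≤ (2 * (1 + (k:ℝ≥0∞))) * (c * B k) := by
        gcongr
        rw [mul_add, mul_one, add_comm]
        gcongr
        exact le_mul_of_one_le_left zero_le one_le_two
    _ = _ := by ring

variable {m : ℕ}

lemma box_rho_le {η : ℝ → ℝ} (hη : IsBump η) {p : ℝ≥0∞} (hp : 0 < p)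
    {ρ : ℝ} (hρ : 0 < ρ) (hρ1 : ρ ≤ 1) (hρp : p ≠ ∞ → ρ ≤ p.toReal) (j : ℕ)
    (f : 𝓢(EuclideanSpace ℝ (Fin (m+1)), ℂ)) :
    eLpNorm (dyadicBox η j (traceFn (f : _ → ℂ))) p volume ^ ρ ≤
      ∑' k, eLpNorm (Tpc η j k (f : _ → ℂ)) p volume ^ ρ := by
  have hm : ∀ k, AEStronglyMeasurable (Tpc η j k (f : _ → ℂ)) volume := fun k =>
    (Tpc_continuous hη j k f).aestronglyMeasurable
  rw [← ENNReal.le_rpow_inv_iff hρ]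
  refine Lp.eLpNorm_le_of_ae_tendsto (u := Filter.atTop)
    (f := fun N => ∑ k ∈ Finset.range (N + 1), Tpc η j k (f : _ → ℂ)) ?_ ?_ ?_
  · refine Filter.Eventually.of_forall fun N => ?_
    rw [ENNReal.le_rpow_inv_iff hρ]
    exact (eLpNorm_rho_sum hp hρ hρ1 hρp hm (N + 1)).trans (ENNReal.sum_le_tsum _)
  · exact fun N => Finset.aestronglyMeasurable_sum _ fun i _ => hm i
  · refine Filter.Eventually.of_forall fun x => ?_
    simpa [Finset.sum_apply] using Tpc_tendsto hη j f x

theorem main_bound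
    (m : ℕ) (η : ℝ → ℝ) (hη : IsBump η)
    (p q : ℝ≥0∞) (hp : 0 < p) (hq : 0 < q) (sp : ℝ)
    (hsp : sp = m * (1 / (min p 1).toReal - 1)) :
    ∃ C : ℝ≥0∞, 0 < C ∧ C ≠ ∞ ∧
      ∀ f : SchwartzMap (EuclideanSpace ℝ (Fin (m+1))) ℂ,
        besovNorm η sp p q (traceFn (⇑f)) ≤
          C * besovNormLog η (sp + 1 / p.toReal) p (min p (min q 1)) (⇑f) := by
  obtain ⟨C, hC, hT⟩ := Tpc_bound (m := m) hη p hp sp hsp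
  have hmt : min p (min q 1) ≠ ∞ :=
    (((min_le_right _ _).trans (min_le_right _ _)).trans_lt ENNReal.one_lt_top).ne
  have hm0 : 0 < min p (min q 1) := lt_min hp (lt_min hq one_pos)
  set ρ := (min p (min q 1)).toReal with hρdef
  have hρ : 0 < ρ := ENNReal.toReal_pos hm0.ne' hmt
  have hρ1 : ρ ≤ 1 := by
    simpa using ENNReal.toReal_mono ENNReal.one_ne_top
      ((min_le_right p (min q 1)).trans (min_le_right q 1))
  have hρp : p ≠ ∞ → ρ ≤ p.toReal := fun h => ENNReal.toReal_mono h (min_le_left _ _)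
  have hρq : q ≠ ∞ → ρ ≤ q.toReal := fun h =>
    ENNReal.toReal_mono h ((min_le_right _ _).trans (min_le_left _ _))
  have hK : (2 * C ^ ρ) ^ (1 / ρ) ≠ ∞ := ENNReal.rpow_ne_top_of_nonneg (by positivity)
    (ENNReal.mul_ne_top (by simp) (ENNReal.rpow_ne_top_of_nonneg hρ.le hC))
  refine ⟨(2 * C ^ ρ) ^ (1 / ρ) + 1, by positivity, ENNReal.add_ne_top.2 ⟨hK, by simp⟩, ?_⟩
  intro f
  unfold besovNorm besovNormLog
  rw [if_neg hmt]
  refine (lqSum_le_rho hρ hρq _).trans ?_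
  refine le_trans ?_ (mul_le_mul' (le_self_add (b := (1 : ℝ≥0∞))) le_rfl)
  rw [← hρdef, ← ENNReal.mul_rpow_of_nonneg _ _ (by positivity)]
  refine ENNReal.rpow_le_rpow ?_ (by positivity)
  refine le_trans (ENNReal.tsum_le_tsum fun j => ?_) (sum_swap _ _)
  rw [ENNReal.mul_rpow_of_nonneg _ _ hρ.le]
  refine (mul_le_mul' le_rfl (box_rho_le hη hp hρ hρ1 hρp j f)).trans ?_
  rw [← ENNReal.tsum_mul_left]
  refine ENNReal.tsum_le_tsum fun k => ?_
  split_ifs with hjk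
  · rw [← ENNReal.mul_rpow_of_nonneg _ _ hρ.le, ← ENNReal.mul_rpow_of_nonneg _ _ hρ.le]
    exact ENNReal.rpow_le_rpow (hT j k hjk f) hρ.le
  · have : Tpc η j k (f : _ → ℂ) = 0 := funext fun x => Tpc_zero hη (by omega) f x
    rw [this, eLpNorm_zero, ENNReal.zero_rpow_of_pos hρ, mul_zero]

end Part5

/-- For `n = m+1 ≥ 2`, `0 < p, q ≤ ∞` and
`s_p = (n-1)(1/min(p,1) - 1)`, the trace satisfies
`‖Tr f‖_{B^{s_p}_{p,q}(ℝ^{n-1})} ≤ C ‖f‖_{B̃^{s_p+1/p}_{p,min(p,q,1)}(ℝⁿ)}`. -/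
theorem trace_besov_limit_bound
    (m : ℕ) (hm : 1 ≤ m) (η : ℝ → ℝ) (hη : IsBump η)
    (p q : ℝ≥0∞) (hp : 0 < p) (hq : 0 < q) (sp : ℝ)
    (hsp : sp = m * (1 / (min p 1).toReal - 1)) :
    ∃ C : ℝ≥0∞, 0 < C ∧ C ≠ ∞ ∧
      ∀ f : SchwartzMap (EuclideanSpace ℝ (Fin (m+1))) ℂ,
        besovNorm η sp p q (traceFn (⇑f)) ≤
          C * besovNormLog η (sp + 1 / p.toReal) p (min p (min q 1)) (⇑f) := by
  exact main_bound m η hη p q hp hq sp hsp
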